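/- Let B be a unital C*-algebra, ψ₁, …, ψ_d a Cuntz family of order d in B with canonical endomorphism σ, A ⊆ B a unital C*-subalgebra, r ≥ 0, and ε ∈ B with ε* ε = 1. Suppose t, φ ∈ B satisfy t a = σ^r(a) t and φ a = σ^r(a) φ for all a ∈ A, together with σ(t) = ε t and σ(φ) = ε φ. Then t* φ commutes with every element of A and with every ψᵢ and ψᵢ*; consequently t* φ lies in the relative commutant of the C*-subalgebra of B generated by A and {ψ₁, …, ψ_d}. -/

import Mathlib

/-- A Cuntz family of order `d` in a unital C*-algebra `B`:  a family
`ψ₁, …, ψ_d` with `ψᵢ* ψⱼ = δᵢⱼ 1` and `Σᵢ ψᵢ ψᵢ* = 1`. -/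
def IsCuntzFamily {B : Type*} [CStarAlgebra B] {d : ℕ} (ψ : Fin d → B) : Prop :=
  (∀ i j, star (ψ i) * ψ j = if i = j then (1 : B) else 0) ∧
    ∑ i, ψ i * star (ψ i) = 1

/-- The canonical endomorphism `σ(b) := Σᵢ ψᵢ b ψᵢ*` of a Cuntz family. -/
def cuntzEndo {B : Type*} [CStarAlgebra B] {d : ℕ} (ψ : Fin d → B) (b : B) : B :=
  ∑ i, ψ i * b * star (ψ i)

/-- The word `ψ_J := ψ_{j₁} ⋯ ψ_{j_r}` associated with a multi-index
`J = (j₁, …, j_r) ∈ {1, …, d}^r`. -/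
def cuntzWord {B : Type*} [CStarAlgebra B] {d : ℕ} (ψ : Fin d → B) {r : ℕ}
    (J : Fin r → Fin d) : B :=
  (List.ofFn fun k => ψ (J k)).prod

/-- The permutation operator
`θ(p) := Σ_{l₁,…,l_r} ψ_{l_{p(1)}} ⋯ ψ_{l_{p(r)}} ψ_{l_r}* ⋯ ψ_{l₁}*`. -/
def cuntzPermOp {B : Type*} [CStarAlgebra B] {d : ℕ} (ψ : Fin d → B) {r : ℕ}
    (p : Equiv.Perm (Fin r)) : B :=
  ∑ l : Fin r → Fin d, cuntzWord ψ (l ∘ p) * star (cuntzWord ψ l)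

lemma star_cuntzEndo {B : Type*} [CStarAlgebra B] {d : ℕ} (ψ : Fin d → B) (b : B) :
    star (cuntzEndo ψ b) = cuntzEndo ψ (star b) := by
  simp [cuntzEndo, star_sum, mul_assoc]

lemma star_iterate_cuntzEndo {B : Type*} [CStarAlgebra B] {d : ℕ} (ψ : Fin d → B) (r : ℕ)
    (b : B) : star ((cuntzEndo ψ)^[r] b) = (cuntzEndo ψ)^[r] (star b) :=
  Function.Semiconj.iterate_right (f := star) (star_cuntzEndo ψ) r b

lemma IsCuntzFamily.cuntzEndo_mul_apply {B : Type*} [CStarAlgebra B] {d : ℕ} {ψ : Fin d → B}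
    (hψ : IsCuntzFamily ψ) (b : B) (i : Fin d) : cuntzEndo ψ b * ψ i = ψ i * b := by
  simp [cuntzEndo, Finset.sum_mul, mul_assoc, hψ.1]

lemma IsCuntzFamily.star_apply_mul_cuntzEndo {B : Type*} [CStarAlgebra B] {d : ℕ}
    {ψ : Fin d → B} (hψ : IsCuntzFamily ψ) (b : B) (i : Fin d) :
    star (ψ i) * cuntzEndo ψ b = b * star (ψ i) := by
  simpa [star_cuntzEndo] using congrArg star (hψ.cuntzEndo_mul_apply (star b) i)

lemma IsCuntzFamily.cuntzEndo_mul {B : Type*} [CStarAlgebra B] {d : ℕ} {ψ : Fin d → B}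
    (hψ : IsCuntzFamily ψ) (b c : B) :
    cuntzEndo ψ (b * c) = cuntzEndo ψ b * cuntzEndo ψ c := by
  conv_rhs => rw [cuntzEndo.eq_def ψ c, Finset.mul_sum]
  simp only [← mul_assoc, hψ.cuntzEndo_mul_apply]
  simp only [cuntzEndo, mul_assoc]

lemma IsCuntzFamily.cuntzEndo_star_mul_eq_self {B : Type*} [CStarAlgebra B] {d : ℕ}
    {ψ : Fin d → B} (hψ : IsCuntzFamily ψ) {ε t φ : B} (hε : star ε * ε = 1)
    (ht : cuntzEndo ψ t = ε * t) (hφ : cuntzEndo ψ φ = ε * φ) :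
    cuntzEndo ψ (star t * φ) = star t * φ := by
  rw [hψ.cuntzEndo_mul, ← star_cuntzEndo, ht, hφ, star_mul, mul_assoc, ← mul_assoc (star ε),
    hε, one_mul]

lemma star_mul_mul_eq_of_intertwines {B : Type*} [CStarAlgebra B] {d : ℕ} {ψ : Fin d → B}
    {A : StarSubalgebra ℂ B} {r : ℕ} {t φ : B}
    (ht : ∀ a ∈ A, t * a = (cuntzEndo ψ)^[r] a * t)
    (hφ : ∀ a ∈ A, φ * a = (cuntzEndo ψ)^[r] a * φ) {a : B} (ha : a ∈ A) :
    star t * φ * a = a * (star t * φ) := by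
  have h : a * star t = star t * (cuntzEndo ψ)^[r] a := by
    simpa [star_iterate_cuntzEndo] using congrArg star (ht (star a) (star_mem ha))
  rw [mul_assoc, hφ a ha, ← mul_assoc, ← h, mul_assoc]

/-- An element commuting with a set and with the adjoints of its elements commutes with the
C*-subalgebra generated by the set. -/
lemma mul_eq_mul_of_mem_topologicalClosure_adjoin {B : Type*} [CStarAlgebra B] {s : Set B}
    {x : B} (hx : ∀ c ∈ s, x * c = c * x ∧ x * star c = star c * x) {c : B}
    (hc : c ∈ (StarAlgebra.adjoin ℂ s).topologicalClosure) : x * c = c * x := by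
  have hle : StarAlgebra.adjoin ℂ s ≤ StarSubalgebra.centralizer ℂ {x} := by
    refine StarAlgebra.adjoin_le fun c hc => ?_
    rw [SetLike.mem_coe, StarSubalgebra.mem_centralizer_iff]
    rintro _ rfl
    exact ⟨(hx c hc).1, by simpa using (congrArg star (hx c hc).2).symm⟩
  have hmem := StarSubalgebra.topologicalClosure_minimal hle (Set.isClosed_centralizer _) hc
  exact ((StarSubalgebra.mem_centralizer_iff ℂ).1 hmem x rfl).1

/-- **Central elements of the crossed product from symmetry intertwiners.**
Let `ψ₁, …, ψ_d` be a Cuntz family of order `d` in a unital C*-algebra `B` with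
canonical endomorphism `σ`, `A ⊆ B` a unital C*-subalgebra, `r ≥ 0`, and
`ε ∈ B` with `ε* ε = 1`.  Suppose `t, φ ∈ B` satisfy `t a = σ^r(a) t` and
`φ a = σ^r(a) φ` for all `a ∈ A`, and `σ(t) = ε t`, `σ(φ) = ε φ`.  Then `t* φ`
commutes with every element of `A` and with every `ψᵢ` and `ψᵢ*`; consequently
`t* φ` lies in the relative commutant of the C*-subalgebra of `B` generated by
`A` and `{ψ₁, …, ψ_d}`. -/
theorem star_mul_central_in_crossed_product {B : Type*} [CStarAlgebra B]
    {d : ℕ} (ψ : Fin d → B) (hψ : IsCuntzFamily ψ)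
    (A : StarSubalgebra ℂ B) (hA : IsClosed (A : Set B))
    (r : ℕ) (ε : B) (hε : star ε * ε = 1)
    (t φ : B)
    (ht : ∀ a ∈ A, t * a = (cuntzEndo ψ)^[r] a * t)
    (hφ : ∀ a ∈ A, φ * a = (cuntzEndo ψ)^[r] a * φ)
    (hσt : cuntzEndo ψ t = ε * t) (hσφ : cuntzEndo ψ φ = ε * φ) :
    (∀ a ∈ A, (star t * φ) * a = a * (star t * φ)) ∧
    (∀ i, (star t * φ) * ψ i = ψ i * (star t * φ) ∧
      (star t * φ) * star (ψ i) = star (ψ i) * (star t * φ)) ∧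
    (∀ c ∈ (StarAlgebra.adjoin ℂ ((A : Set B) ∪ Set.range ψ)).topologicalClosure,
      (star t * φ) * c = c * (star t * φ)) := by
  have hfix := hψ.cuntzEndo_star_mul_eq_self hε hσt hσφ
  have hA_comm : ∀ a ∈ A, star t * φ * a = a * (star t * φ) := fun a ha =>
    star_mul_mul_eq_of_intertwines ht hφ ha
  have hψ_comm : ∀ i, star t * φ * ψ i = ψ i * (star t * φ) ∧
      star t * φ * star (ψ i) = star (ψ i) * (star t * φ) := fun i =>
    ⟨by simpa only [hfix] using hψ.cuntzEndo_mul_apply (star t * φ) i,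
      by simpa only [hfix] using (hψ.star_apply_mul_cuntzEndo (star t * φ) i).symm⟩
  refine ⟨hA_comm, hψ_comm, fun c hc => mul_eq_mul_of_mem_topologicalClosure_adjoin ?_ hc⟩
  rintro _ (ha | ⟨i, rfl⟩)
  · exact ⟨hA_comm _ ha, hA_comm _ (star_mem ha)⟩
  · exact hψ_comm i
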